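/- arXiv:1512.03242 — 3 statements merged into one kernel-verified Lean document; each statement's English description precedes it below -/
import Mathlib

section
/- Let F = GF(8) and let β, γ ∈ F with β ≠ γ. For all X ∈ H_β and Y ∈ H_γ, the coset {X Δ Y Δ Z : Z ∈ H̄_β ∩ H̄_γ} does not contain the empty set and contains exactly one element of cardinality 2 (its unique leader, of weight 2). -/
open scoped symmDiff

noncomputable instance : Fintype (GaloisField 2 3) := Fintype.ofFinite _
noncomputable instance : DecidableEq (GaloisField 2 3) := Classical.decEq _

/-- The even-weight code `H̄_β`: subsets `X` of `GF(8)` with `|X|` even and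
`∑_{x ∈ X} (x + β)^3 = 0`. -/
def Hbar (β : GaloisField 2 3) : Set (Finset (GaloisField 2 3)) :=
  {X | Even X.card ∧ ∑ x ∈ X, (x + β) ^ 3 = 0}

/-- The odd-weight code `H_β`: subsets `X` of `GF(8)` with `|X|` odd and
`∑_{x ∈ X} (x + β)^3 = 0`. -/
def Hodd (β : GaloisField 2 3) : Set (Finset (GaloisField 2 3)) :=
  {X | Odd X.card ∧ ∑ x ∈ X, (x + β) ^ 3 = 0}

section aux


lemma k_two : (2 : (GaloisField 2 3)) = 0 := by
  have := CharP.cast_eq_zero (GaloisField 2 3) 2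
  simpa using this

lemma k_pow8 (x : (GaloisField 2 3)) : x ^ 8 = x := by
  have h := FiniteField.pow_card x
  have hc : Fintype.card (GaloisField 2 3) = 8 := by
    rw [← Nat.card_eq_fintype_card, GaloisField.card 2 3 (by norm_num)]
    norm_num
  rwa [hc] at h

lemma k_pow7 (x : (GaloisField 2 3)) (hx : x ≠ 0) : x ^ 7 = 1 := by
  have h := k_pow8 x
  apply mul_left_cancel₀ hx
  linear_combination h

lemma k_add_eq_zero (x y : (GaloisField 2 3)) : x + y = 0 ↔ x = y := by
  have h2 := k_two
  constructor
  · intro h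
    linear_combination h - y * h2
  · intro h
    linear_combination h + y * h2

/-- trace -/
noncomputable def ktr (x : (GaloisField 2 3)) : (GaloisField 2 3) := x + x ^ 2 + x ^ 4

lemma ktr_add (x y : (GaloisField 2 3)) : ktr (x + y) = ktr x + ktr y := by
  have h2 := k_two
  unfold ktr
  linear_combination (x * y + 2 * x ^ 3 * y + 3 * x ^ 2 * y ^ 2 + 2 * x * y ^ 3) * h2

lemma ktr_cases (x : (GaloisField 2 3)) : ktr x = 0 ∨ ktr x = 1 := by
  have h2 := k_two
  have h8 := k_pow8 x
  have : ktr x * (ktr x + 1) = 0 := by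
    unfold ktr
    linear_combination h8 + (x + x ^ 2 + x ^ 3 + x ^ 4 + x ^ 5 + x ^ 6) * h2
  rcases mul_eq_zero.mp this with h | h
  · exact Or.inl h
  · exact Or.inr ((k_add_eq_zero _ _).mp h)

lemma ktr_art (r : (GaloisField 2 3)) : ktr (r ^ 2 + r + 1) = 1 := by
  have h2 := k_two
  have h8 := k_pow8 r
  have e : ktr (r ^ 2 + r) = 0 := by
    rw [ktr_add]
    unfold ktr
    linear_combination h8 + (r + r ^ 2 + r ^ 4) * h2
  rw [ktr_add, e]
  unfold ktr
  linear_combination h2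

lemma exists_art (y : (GaloisField 2 3)) (h : ktr y = 1) : ∃ q : (GaloisField 2 3), q ^ 2 + q + 1 = y := by
  have h2 := k_two
  have h8 := k_pow8 y
  refine ⟨y + y ^ 4, ?_⟩
  unfold ktr at h
  linear_combination h8 + h + (y ^ 5 + 1) * h2

lemma pair_trace (B a s : (GaloisField 2 3)) (hs : s ≠ 0) (h : a ^ 3 + (a + s) ^ 3 = B) :
    ktr (B * s ^ 4) = 1 := by
  have h2 := k_two
  have h7 := k_pow7 s hs
  have : B * s ^ 4 = (a * s ^ 6) ^ 2 + a * s ^ 6 + 1 := by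
    linear_combination (-s ^ 4) * h - (a ^ 2 * s ^ 5 - 1) * h7 +
      (a ^ 3 * s ^ 4 + a ^ 2 * s ^ 5 + a * s ^ 6) * h2
  rw [this, ktr_art]

lemma trace_sum (δ v w : (GaloisField 2 3)) (hδ : δ ≠ 0) :
    ktr ((δ * v ^ 2 + δ ^ 2 * v + δ ^ 3) * w ^ 4) +
    ktr ((δ * v ^ 2 + δ ^ 2 * v + δ ^ 3) * (w + δ) ^ 4) = 1 := by
  have h2 := k_two
  have h7 := k_pow7 δ hδ
  rw [← ktr_add, ← ktr_art (v * δ ^ 6)]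
  congr 1
  have e : (w + δ) ^ 4 = w ^ 4 + δ ^ 4 := by
    linear_combination (2 * w ^ 3 * δ + 3 * w ^ 2 * δ ^ 2 + 2 * w * δ ^ 3) * h2
  rw [e]
  linear_combination ((δ * v ^ 2 + δ ^ 2 * v + δ ^ 3) * w ^ 4) * h2 +
    (1 - v ^ 2 * δ ^ 5) * h7

lemma pair_sum (δ w a b E : (GaloisField 2 3)) (hδ : δ ≠ 0) (hE : E = δ * w ^ 2 + δ ^ 2 * w)
    (h : a ^ 3 + b ^ 3 + ((a + δ) ^ 3 + (b + δ) ^ 3) = E) :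
    a + b = w ∨ a + b = w + δ := by
  have h2 := k_two
  have : δ * ((a + b + w) * (a + b + (w + δ))) = 0 := by
    subst hE
    linear_combination h + (δ * w ^ 2 + δ ^ 2 * w - a ^ 3 - b ^ 3 - δ ^ 3 +
      δ * (a + b) * w + δ * a * b - δ * a ^ 2 - δ * b ^ 2 - δ ^ 2 * a - δ ^ 2 * b) * h2
  rcases mul_eq_zero.mp this with h | h
  · exact absurd h hδ
  rcases mul_eq_zero.mp h with h | h
  · exact Or.inl ((k_add_eq_zero _ _).mp h)
  · exact Or.inr ((k_add_eq_zero _ _).mp h)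

lemma core_pair (δ v w B C : (GaloisField 2 3)) (hδ : δ ≠ 0) (hB : B = δ * v ^ 2 + δ ^ 2 * v + δ ^ 3)
    (hC : B + C = δ * w ^ 2 + δ ^ 2 * w) :
    ∃ a b : (GaloisField 2 3), a ≠ b ∧ a ^ 3 + b ^ 3 = B ∧ (a + δ) ^ 3 + (b + δ) ^ 3 = C ∧
      ∀ c d : (GaloisField 2 3), c ≠ d → c ^ 3 + d ^ 3 = B → (c + δ) ^ 3 + (d + δ) ^ 3 = C →
        (c = a ∧ d = b) ∨ (c = b ∧ d = a) := by
  have h2 := k_two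
  have hsum := trace_sum δ v w hδ
  rw [← hB] at hsum
  obtain ⟨s, hs1, hsE, hso⟩ : ∃ s : (GaloisField 2 3), ktr (B * s ^ 4) = 1 ∧ B + C = δ * s ^ 2 + δ ^ 2 * s ∧
      ktr (B * (s + δ) ^ 4) = 0 := by
    rcases ktr_cases (B * w ^ 4) with h | h
    · refine ⟨w + δ, ?_, ?_, ?_⟩
      · rw [h, zero_add] at hsum
        exact hsum
      · linear_combination hC - (δ ^ 2 * w + δ ^ 3) * h2
      · have : w + δ + δ = w := by linear_combination δ * h2
        rw [this, h]
    · refine ⟨w, h, hC, ?_⟩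
      rw [h] at hsum
      linear_combination hsum
  have hs0 : s ≠ 0 := by
    rintro rfl
    simp [ktr] at hs1
  have h7 := k_pow7 s hs0
  obtain ⟨q, hq⟩ := exists_art _ hs1
  have hab : (s * q) ^ 3 + (s * q + s) ^ 3 = B := by
    linear_combination s ^ 3 * hq + B * h7 + (s ^ 3 * q ^ 3 + s ^ 3 * q ^ 2 + s ^ 3 * q) * h2
  refine ⟨s * q, s * q + s, ?_, hab, ?_, ?_⟩
  · intro h
    apply hs0
    linear_combination -h
  · generalize s * q = a at *
    linear_combination hab - B * h2 + hsE +
      (3 * a ^ 2 * δ + 3 * a * δ ^ 2 + 3 * a * s * δ + δ ^ 3 + 2 * δ * s ^ 2 + 2 * δ ^ 2 * s + B - C) * h2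
  · intro c d hcd h3 h3'
    have hsum' := pair_sum δ s c d (B + C) hδ hsE (by rw [h3, h3'])
    have hcd0 : c + d ≠ 0 := fun h => hcd ((k_add_eq_zero _ _).mp h)
    have hd : d = c + (c + d) := by linear_combination -c * h2
    have ht := pair_trace B c (c + d) hcd0 (by rw [← hd]; exact h3)
    rcases hsum' with h | h
    · generalize s * q = a at *
      have hd' : d = c + s := by rw [← h]; exact hd
      have : s * ((c + a) * (c + (a + s))) = 0 := by
        rw [hd'] at h3
        linear_combination h3 + hab - (c ^ 3 + c ^ 2 * s + c * s ^ 2 + s ^ 3 + a ^ 3 + a ^ 2 * s + a * s ^ 2 - B - a * c * s) * h2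
      rcases mul_eq_zero.mp this with h | h
      · exact absurd h hs0
      rcases mul_eq_zero.mp h with h | h
      · have := (k_add_eq_zero _ _).mp h
        left
        exact ⟨this, by rw [hd', this]⟩
      · have := (k_add_eq_zero _ _).mp h
        right
        refine ⟨this, ?_⟩
        rw [hd', this]
        linear_combination s * h2
    · rw [h, hso] at ht
      exact absurd ht zero_ne_one

lemma sum_symmDiff_k (A B : Finset (GaloisField 2 3)) (f : (GaloisField 2 3) → (GaloisField 2 3)) :
    ∑ x ∈ A ∆ B, f x = ∑ x ∈ A, f x + ∑ x ∈ B, f x := by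
  have h2 := k_two
  have h1 : ∑ x ∈ A ∆ B, f x = ∑ x ∈ A \ B, f x + ∑ x ∈ B \ A, f x := by
    rw [symmDiff_def, Finset.sup_eq_union, Finset.sum_union disjoint_sdiff_sdiff]
  have hA := Finset.sum_inter_add_sum_sdiff A B f
  have hB := Finset.sum_inter_add_sum_sdiff B A f
  rw [Finset.inter_comm] at hB
  rw [h1, ← hA, ← hB]
  linear_combination -(∑ x ∈ A ∩ B, f x) * h2

lemma even_iff_k (A : Finset (GaloisField 2 3)) : Even A.card ↔ ∑ _x ∈ A, (1 : (GaloisField 2 3)) = 0 := by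
  rw [even_iff_two_dvd, ← CharP.cast_eq_zero_iff (GaloisField 2 3) 2]
  simp

lemma odd_k (A : Finset (GaloisField 2 3)) (h : Odd A.card) : ∑ _x ∈ A, (1 : (GaloisField 2 3)) = 1 := by
  have h2 := k_two
  obtain ⟨k, hk⟩ := h
  rw [Finset.sum_const, hk]
  simp [h2]

lemma odd_shift (A : Finset (GaloisField 2 3)) (β δ : (GaloisField 2 3)) (h : Odd A.card) (h0 : ∑ x ∈ A, (x + β) ^ 3 = 0) :
    ∑ x ∈ A, (x + (β + δ)) ^ 3 =
      δ * (∑ x ∈ A, (x + β)) ^ 2 + δ ^ 2 * (∑ x ∈ A, (x + β)) + δ ^ 3 := by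
  have h2 := k_two
  have e : (∑ x ∈ A, (x + β)) ^ 2 = ∑ x ∈ A, (x + β) ^ 2 := sum_pow_char 2 _ _
  have e1 := odd_k A h
  have : ∑ x ∈ A, (x + (β + δ)) ^ 3 = ∑ x ∈ A, (x + β) ^ 3 + δ * ∑ x ∈ A, (x + β) ^ 2 +
      δ ^ 2 * (∑ x ∈ A, (x + β)) + δ ^ 3 * ∑ _x ∈ A, (1 : (GaloisField 2 3)) := by
    simp only [Finset.mul_sum, ← Finset.sum_add_distrib]
    refine Finset.sum_congr rfl fun x _ => ?_
    linear_combination ((x + β) ^ 2 * δ + (x + β) * δ ^ 2) * h2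
  rw [this, h0, e, e1]
  ring

lemma mem_coset_iff (β γ : (GaloisField 2 3)) (X Y V : Finset (GaloisField 2 3)) (hX : X ∈ Hodd β) (hY : Y ∈ Hodd γ) :
    (∃ Z ∈ Hbar β ∩ Hbar γ, V = X ∆ Y ∆ Z) ↔
      Even V.card ∧ ∑ x ∈ V, (x + β) ^ 3 = ∑ x ∈ Y, (x + β) ^ 3 ∧
        ∑ x ∈ V, (x + γ) ^ 3 = ∑ x ∈ X, (x + γ) ^ 3 := by
  have h2 := k_two
  obtain ⟨oX, zX⟩ := hX
  obtain ⟨oY, zY⟩ := hY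
  have o1 := odd_k X oX
  have o2 := odd_k Y oY
  constructor
  · rintro ⟨Z, ⟨⟨hZ, hZβ⟩, ⟨-, hZγ⟩⟩, rfl⟩
    rw [even_iff_k] at hZ ⊢
    simp only [sum_symmDiff_k, o1, o2, hZ, zX, zY, hZβ, hZγ]
    refine ⟨?_, by ring, by ring⟩
    linear_combination h2
  · rintro ⟨hV, hβ, hγ⟩
    rw [even_iff_k] at hV
    refine ⟨X ∆ Y ∆ V, ⟨⟨?_, ?_⟩, ⟨?_, ?_⟩⟩, (symmDiff_symmDiff_cancel_left _ _).symm⟩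
    · rw [even_iff_k]
      simp only [sum_symmDiff_k, o1, o2, hV]
      linear_combination h2
    · simp only [sum_symmDiff_k, zX, hβ]
      linear_combination (∑ x ∈ Y, (x + β) ^ 3) * h2
    · rw [even_iff_k]
      simp only [sum_symmDiff_k, o1, o2, hV]
      linear_combination h2
    · simp only [sum_symmDiff_k, zY, hγ]
      linear_combination (∑ x ∈ X, (x + γ) ^ 3) * h2

end aux

theorem stmt_7 (β γ : GaloisField 2 3) (hβγ : β ≠ γ)
    (X Y : Finset (GaloisField 2 3)) (hX : X ∈ Hodd β) (hY : Y ∈ Hodd γ) :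
    (∅ : Finset (GaloisField 2 3)) ∉ {V | ∃ Z ∈ Hbar β ∩ Hbar γ, V = X ∆ Y ∆ Z} ∧
    ∃! W, W ∈ {V | ∃ Z ∈ Hbar β ∩ Hbar γ, V = X ∆ Y ∆ Z} ∧ W.card = 2 := by
  have h2 := k_two
  simp only [Set.mem_ofPred_eq, mem_coset_iff β γ X Y _ hX hY]
  have hδ : β + γ ≠ 0 := fun h => hβγ ((k_add_eq_zero _ _).mp h)
  have hC := odd_shift X β (β + γ) hX.1 hX.2
  have hB := odd_shift Y γ (β + γ) hY.1 hY.2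
  rw [show β + (β + γ) = γ by linear_combination β * h2] at hC
  rw [show γ + (β + γ) = β by linear_combination γ * h2] at hB
  generalize ∑ x ∈ Y, (x + β) ^ 3 = B at *
  generalize ∑ x ∈ X, (x + γ) ^ 3 = C at *
  generalize ∑ x ∈ X, (x + β) = u at *
  generalize ∑ x ∈ Y, (x + γ) = v at *
  obtain ⟨a, b, hab, e1, e2, hu⟩ := core_pair (β + γ) v (u + v) B C hδ hB (by
    rw [hB, hC]
    linear_combination ((β + γ) ^ 3 - (β + γ) * u * v) * h2)
  have key : ∀ x : GaloisField 2 3, x + β + (β + γ) = x + γ := fun x => by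
    linear_combination β * h2
  have key' : ∀ x : GaloisField 2 3, x + β + β = x := fun x => by
    linear_combination β * h2
  constructor
  · rintro ⟨-, h, -⟩
    rw [Finset.sum_empty] at h
    have := trace_sum (β + γ) v 0 hδ
    rw [← hB, ← h] at this
    simp [ktr] at this
  · have hab' : a + β ≠ b + β := fun h => hab (add_right_cancel h)
    refine ⟨{a + β, b + β}, ⟨⟨?_, ?_, ?_⟩, ?_⟩, ?_⟩
    · rw [Finset.card_pair hab']
      decide
    · rw [Finset.sum_pair hab', key', key', e1]
    · rw [Finset.sum_pair hab', add_assoc a, add_assoc b, e2]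
    · exact Finset.card_pair hab'
    · rintro W ⟨⟨-, f1, f2⟩, hW⟩
      obtain ⟨c, d, hcd, rfl⟩ := Finset.card_eq_two.mp hW
      rw [Finset.sum_pair hcd] at f1 f2
      rw [← key c, ← key d] at f2
      rcases hu (c + β) (d + β) (fun h => hcd (add_right_cancel h)) f1 f2 with ⟨h, h'⟩ | ⟨h, h'⟩
      · rw [← h, ← h', key', key']
      · rw [← h, ← h', key', key', Finset.pair_comm]
end

section
/- Let F = GF(8), let β, γ ∈ F with β ≠ γ, and let Π⁰, Π¹ be the complementary 4-element supports of the two weight-4 words of H̄_β ∩ H̄_γ, with β ∈ Π⁰ and γ ∈ Π¹. Then: (1) for X, X' ∈ H_β and Y, Y' ∈ H_γ, the unique weight-2 elements of the cosets {X Δ Y Δ Z : Z ∈ H̄_β ∩ H̄_γ} and {X' Δ Y' Δ Z : Z ∈ H̄_β ∩ H̄_γ} coincide if and only if the two cosets coincide; (2) the set of all such weight-2 leaders, taken over all X ∈ H_β and Y ∈ H_γ, is exactly {{r,s} : r ∈ Π⁰, s ∈ Π¹}. -/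
open scoped symmDiff

/-- The coset `{X ∆ Y ∆ Z : Z ∈ H̄_β ∩ H̄_γ}`. -/
def coset (β γ : GaloisField 2 3) (X Y : Finset (GaloisField 2 3)) :
    Set (Finset (GaloisField 2 3)) :=
  {V | ∃ Z ∈ Hbar β ∩ Hbar γ, V = X ∆ Y ∆ Z}

abbrev MM := ZMod 2 × ZMod 2 × ZMod 2

def mmul (x y : MM) : MM :=
  (x.1 * y.1 + (x.2.1 * y.2.2 + x.2.2 * y.2.1),
   x.1 * y.2.1 + x.2.1 * y.1 + (x.2.1 * y.2.2 + x.2.2 * y.2.1) + x.2.2 * y.2.2,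
   x.1 * y.2.2 + x.2.2 * y.1 + x.2.1 * y.2.1 + x.2.2 * y.2.2)

def mcube (x : MM) : MM := mmul x (mmul x x)

def mone : MM := (1, 0, 0)


def A0 (S : Finset MM) : Prop := ∑ x ∈ S, mcube x = 0
def A1 (S : Finset MM) : Prop := ∑ x ∈ S, mcube (x + mone) = 0
instance (S : Finset MM) : Decidable (A0 S) := by unfold A0; infer_instance
instance (S : Finset MM) : Decidable (A1 S) := by unfold A1; infer_instance

def mT : Finset MM := {(0, 0, 0), (1, 0, 1), (1, 1, 0), (1, 1, 1)}

set_option maxRecDepth 100000 in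
theorem model_C : ∀ S : Finset MM, Even S.card → A0 S → A1 S →
    S = ∅ ∨ S = Finset.univ ∨ S = mT ∨ S = mTᶜ := by decide +kernel

set_option maxRecDepth 100000 in
theorem model_X : ∀ S : Finset MM, Odd S.card → A0 S → Odd (S ∩ mT).card := by decide +kernel

set_option maxRecDepth 100000 in
theorem model_Y : ∀ S : Finset MM, Odd S.card → A1 S → Even (S ∩ mT).card := by decide +kernel

set_option maxRecDepth 100000 in
theorem model_E : ∀ r ∈ mT, ∀ s ∈ mTᶜ, ∃ S : Finset MM, (Odd S.card ∧ A0 S) ∧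
    Odd (symmDiff S {r, s}).card ∧ A1 (symmDiff S {r, s}) := by decide +kernel

theorem model_inv : ∀ x : MM, x ≠ 0 → ∃ y, mmul x y = mone := by decide +kernel

abbrev GF8 := GaloisField 2 3

theorem card_GF8 : Fintype.card GF8 = 8 := by
  have := GaloisField.card 2 3 (by norm_num)
  rw [← Nat.card_eq_fintype_card, this]; norm_num

theorem two_GF8 : (2 : GF8) = 0 := by
  have := CharP.cast_eq_zero GF8 2
  exact_mod_cast this

theorem exists_t : ∃ t : GF8, t ^ 3 = t + 1 := by
  have h2 := two_GF8
  obtain ⟨u, hu⟩ : ∃ u : GF8, u ∉ ({0, 1} : Finset GF8) := by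
    by_contra! h
    have h1 : (Finset.univ : Finset GF8).card ≤ ({0, 1} : Finset GF8).card :=
      Finset.card_le_card fun x _ => h x
    rw [Finset.card_univ, card_GF8] at h1
    have := Finset.card_le_two (a := (0 : GF8)) (b := 1)
    omega
  have h8 : u ^ 8 = u := by
    have := FiniteField.pow_card u
    rwa [card_GF8] at this
  simp only [Finset.mem_insert, Finset.mem_singleton, not_or] at hu
  have hz : u * ((u - 1) * ((u ^ 3 + u + 1) * (u ^ 3 + u ^ 2 + 1))) = 0 := by
    linear_combination h8 + (u ^ 5 - u ^ 4) * h2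
  rcases mul_eq_zero.1 hz with h | h
  · exact absurd h hu.1
  rcases mul_eq_zero.1 h with h | h
  · exact absurd (sub_eq_zero.1 h) hu.2
  rcases mul_eq_zero.1 h with h | h
  · exact ⟨u, by linear_combination h - (u + 1) * h2⟩
  · exact ⟨u + 1, by linear_combination h + (u ^ 2 + u - 1) * h2⟩

noncomputable def phi (t : GF8) : MM →+ GF8 where
  toFun x := algebraMap (ZMod 2) GF8 x.1 + algebraMap (ZMod 2) GF8 x.2.1 * t +
    algebraMap (ZMod 2) GF8 x.2.2 * t ^ 2
  map_zero' := by simp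
  map_add' x y := by simp; ring

theorem phi_mul (t : GF8) (ht : t ^ 3 = t + 1) (x y : MM) :
    phi t (mmul x y) = phi t x * phi t y := by
  obtain ⟨a, b, c⟩ := x
  obtain ⟨a', b', c'⟩ := y
  simp only [phi, mmul, AddMonoidHom.coe_mk, ZeroHom.coe_mk, map_add, map_mul]
  generalize algebraMap (ZMod 2) GF8 a = a
  generalize algebraMap (ZMod 2) GF8 b = b
  generalize algebraMap (ZMod 2) GF8 c = c
  generalize algebraMap (ZMod 2) GF8 a' = a'
  generalize algebraMap (ZMod 2) GF8 b' = b'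
  generalize algebraMap (ZMod 2) GF8 c' = c'
  linear_combination -(b * c' + c * b' + c * c' * t) * ht

theorem phi_one (t : GF8) : phi t mone = 1 := by
  simp [phi, mone]

theorem phi_inj (t : GF8) (ht : t ^ 3 = t + 1) : Function.Injective (phi t) := by
  rw [injective_iff_map_eq_zero]
  intro x hx
  by_contra h
  obtain ⟨y, hy⟩ := model_inv x h
  have := phi_mul t ht x y
  rw [hy, phi_one, hx, zero_mul] at this
  exact one_ne_zero this

theorem phi_cube (t : GF8) (ht : t ^ 3 = t + 1) (x : MM) :
    phi t (mcube x) = phi t x ^ 3 := by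
  rw [mcube, phi_mul t ht, phi_mul t ht]; ring

/-- The affine coordinates. -/
theorem exists_psi (β γ : GF8) (h : β ≠ γ) : ∃ e : MM ≃ GF8, e 0 = β ∧
    (∀ S : Finset MM, S.map e.toEmbedding ∈ Hbar β ↔ Even S.card ∧ A0 S) ∧
    (∀ S : Finset MM, S.map e.toEmbedding ∈ Hbar γ ↔ Even S.card ∧ A1 S) ∧
    (∀ S : Finset MM, S.map e.toEmbedding ∈ Hodd β ↔ Odd S.card ∧ A0 S) ∧
    (∀ S : Finset MM, S.map e.toEmbedding ∈ Hodd γ ↔ Odd S.card ∧ A1 S) := by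
  obtain ⟨t, ht⟩ := exists_t
  have h2 := two_GF8
  have hd : γ - β ≠ 0 := sub_ne_zero.2 h.symm
  let f : MM → GF8 := fun m => β + (γ - β) * phi t m
  have hf : Function.Bijective f := by
    rw [Fintype.bijective_iff_injective_and_card]
    refine ⟨fun x y hxy => ?_, ?_⟩
    · exact phi_inj t ht (mul_left_cancel₀ hd (add_left_cancel hxy))
    · rw [card_GF8]; decide
  have hfb : ∀ m, (f m + β) ^ 3 = (γ - β) ^ 3 * phi t (mcube m) := by
    intro m
    rw [phi_cube t ht, ← mul_pow]
    congr 1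
    simp only [f]
    linear_combination β * h2
  have hfc : ∀ m, (f m + γ) ^ 3 = (γ - β) ^ 3 * phi t (mcube (m + mone)) := by
    intro m
    rw [phi_cube t ht, ← mul_pow, map_add, phi_one]
    congr 1
    simp only [f]
    linear_combination β * h2
  have s0 : ∀ S : Finset MM, ∑ m ∈ S, (f m + β) ^ 3 = 0 ↔ A0 S := by
    intro S
    simp_rw [hfb]
    rw [← Finset.mul_sum, ← map_sum, mul_eq_zero, or_iff_right (pow_ne_zero _ hd),
      map_eq_zero_iff _ (phi_inj t ht)]
    rfl
  have s1 : ∀ S : Finset MM, ∑ m ∈ S, (f m + γ) ^ 3 = 0 ↔ A1 S := by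
    intro S
    simp_rw [hfc]
    rw [← Finset.mul_sum, ← map_sum, mul_eq_zero, or_iff_right (pow_ne_zero _ hd),
      map_eq_zero_iff _ (phi_inj t ht)]
    rfl
  refine ⟨Equiv.ofBijective f hf, by simp [f], ?_, ?_, ?_, ?_⟩ <;> intro S <;>
    simp [Hbar, Hodd, s0, s1]

theorem sum_symmDiff_GF8 (g : GF8 → GF8) (S T : Finset GF8) :
    ∑ x ∈ S ∆ T, g x = ∑ x ∈ S, g x + ∑ x ∈ T, g x := by
  have h2 := two_GF8
  have h1 : S ∆ T = (S \ T) ∪ (T \ S) := rfl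
  rw [h1, Finset.sum_union (Finset.disjoint_left.2 (by grind)),
    ← Finset.sum_inter_add_sum_sdiff S T, ← Finset.sum_inter_add_sum_sdiff T S,
    Finset.inter_comm T S]
  linear_combination -(∑ x ∈ S ∩ T, g x) * h2

theorem card_symmDiff_GF8 (S T : Finset GF8) :
    (S ∆ T).card + 2 * (S ∩ T).card = S.card + T.card := by
  have h1 : S ∆ T = (S \ T) ∪ (T \ S) := rfl
  rw [h1, Finset.card_union_of_disjoint (Finset.disjoint_left.2 (by grind)),
    ← Finset.card_inter_add_card_sdiff S T, ← Finset.card_inter_add_card_sdiff T S,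
    Finset.inter_comm T S]
  ring

theorem Hbar_symmDiff (β : GF8) {S T : Finset GF8} (hS : S ∈ Hbar β) (hT : T ∈ Hbar β) :
    S ∆ T ∈ Hbar β := by
  refine ⟨?_, ?_⟩
  · have := card_symmDiff_GF8 S T
    have h1 := hS.1
    have h2 := hT.1
    grind
  · rw [sum_symmDiff_GF8, hS.2, hT.2, add_zero]

theorem empty_mem_Hbar (β : GF8) : ∅ ∈ Hbar β := by simp [Hbar]

theorem facts (β γ : GF8) (h : β ≠ γ) (P0 : Finset GF8)
    (hP0 : P0 ∈ Hbar β ∩ Hbar γ) (hc0 : P0.card = 4) (hβ : β ∈ P0) :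
    (∀ Z ∈ Hbar β ∩ Hbar γ, Z = ∅ ∨ Z = Finset.univ ∨ Z = P0 ∨ Z = P0ᶜ) ∧
    (∀ X ∈ Hodd β, Odd (X ∩ P0).card) ∧ (∀ Y ∈ Hodd γ, Even (Y ∩ P0).card) ∧
    (∀ r ∈ P0, ∀ s ∈ P0ᶜ, ∃ X ∈ Hodd β, X ∆ {r, s} ∈ Hodd γ) := by
  obtain ⟨e, e0, hb0, hb1, ho0, ho1⟩ := exists_psi β γ h
  have surj : ∀ S : Finset GF8, ∃ T : Finset MM, S = T.map e.toEmbedding := fun S =>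
    ⟨S.map e.symm.toEmbedding, by ext; simp⟩
  have hT : P0 = mT.map e.toEmbedding := by
    obtain ⟨T, rfl⟩ := surj P0
    have hz : (0 : MM) ∈ T := by
      rw [← e0] at hβ
      simpa using hβ
    rw [Finset.card_map] at hc0
    rcases model_C T ((hb0 T).1 hP0.1).1 ((hb0 T).1 hP0.1).2 ((hb1 T).1 hP0.2).2 with
      rfl | rfl | rfl | rfl
    · simp at hz
    · exact absurd hc0 (by decide)
    · rfl
    · exact absurd hz (by decide)
  have hcT : (mT.map e.toEmbedding)ᶜ = mTᶜ.map e.toEmbedding := by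
    ext x; simp
  subst hT
  refine ⟨?_, ?_, ?_, ?_⟩
  · intro Z hZ
    obtain ⟨T, rfl⟩ := surj Z
    rcases model_C T ((hb0 T).1 hZ.1).1 ((hb0 T).1 hZ.1).2 ((hb1 T).1 hZ.2).2 with
      rfl | rfl | rfl | rfl
    · simp
    · simp
    · simp
    · simp only [hcT]; simp
  · intro X hX
    obtain ⟨T, rfl⟩ := surj X
    rw [← Finset.map_inter, Finset.card_map]
    exact model_X T ((ho0 T).1 hX).1 ((ho0 T).1 hX).2
  · intro X hX
    obtain ⟨T, rfl⟩ := surj X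
    rw [← Finset.map_inter, Finset.card_map]
    exact model_Y T ((ho1 T).1 hX).1 ((ho1 T).1 hX).2
  · intro r hr s hs
    rw [hcT] at hs
    obtain ⟨r, hr1, rfl⟩ := Finset.mem_map.1 hr
    obtain ⟨s, hs1, rfl⟩ := Finset.mem_map.1 hs
    obtain ⟨S, h1, h2⟩ := model_E r hr1 s hs1
    refine ⟨S.map e.toEmbedding, (ho0 S).2 h1, ?_⟩
    convert (ho1 _).2 h2 using 1
    ext x
    simp [Finset.mem_symmDiff, Equiv.symm_apply_eq]

theorem coset_eq_of_mem {β γ : GF8} {X Y W : Finset GF8} (h : W ∈ coset β γ X Y) :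
    coset β γ X Y = {V | W ∆ V ∈ Hbar β ∩ Hbar γ} := by
  obtain ⟨Z, hZ, rfl⟩ := h
  ext V
  constructor
  · rintro ⟨Z', hZ', rfl⟩
    have : (X ∆ Y ∆ Z) ∆ (X ∆ Y ∆ Z') = Z ∆ Z' := by
      ext x; simp only [Finset.mem_symmDiff]; tauto
    simp only [Set.mem_ofPred_eq, this]
    exact ⟨Hbar_symmDiff _ hZ.1 hZ'.1, Hbar_symmDiff _ hZ.2 hZ'.2⟩
  · intro hV
    refine ⟨Z ∆ ((X ∆ Y ∆ Z) ∆ V), ⟨Hbar_symmDiff _ hZ.1 hV.1, Hbar_symmDiff _ hZ.2 hV.2⟩, ?_⟩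
    ext x; simp only [Finset.mem_symmDiff]; tauto


theorem stmt_8 (β γ : GaloisField 2 3) (hβγ : β ≠ γ)
    (P0 P1 : Finset (GaloisField 2 3))
    (hP0 : P0 ∈ Hbar β ∩ Hbar γ) (hP1 : P1 ∈ Hbar β ∩ Hbar γ)
    (hc0 : P0.card = 4) (hc1 : P1.card = 4) (hcompl : P1 = P0ᶜ)
    (hβ : β ∈ P0) (hγ : γ ∈ P1) :
    (∀ X ∈ Hodd β, ∀ X' ∈ Hodd β, ∀ Y ∈ Hodd γ, ∀ Y' ∈ Hodd γ,
      ∀ W W' : Finset (GaloisField 2 3),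
        W.card = 2 → W'.card = 2 → W ∈ coset β γ X Y → W' ∈ coset β γ X' Y' →
        (W = W' ↔ coset β γ X Y = coset β γ X' Y')) ∧
    {W : Finset (GaloisField 2 3) |
        ∃ X ∈ Hodd β, ∃ Y ∈ Hodd γ, W ∈ coset β γ X Y ∧ W.card = 2} =
      {W : Finset (GaloisField 2 3) | ∃ r ∈ P0, ∃ s ∈ P1, W = {r, s}} := by
  obtain ⟨f1, f2, f3, f4⟩ := facts β γ hβγ P0 hP0 hc0 hβ
  have inter_sd : ∀ A B : Finset (GaloisField 2 3), (A ∆ B) ∩ P0 = (A ∩ P0) ∆ (B ∩ P0) := by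
    intro A B
    ext x; simp only [Finset.mem_symmDiff, Finset.mem_inter]; tauto
  have par : ∀ X ∈ Hodd β, ∀ Y ∈ Hodd γ, ∀ W ∈ coset β γ X Y, W.card = 2 →
      (W ∩ P0).card = 1 ∧ (W \ P0).card = 1 := by
    rintro X hX Y hY W ⟨Z, hZ, rfl⟩ hW
    have hz : Even (Z ∩ P0).card := by
      rcases f1 Z hZ with rfl | rfl | rfl | rfl
      · simp
      · rw [Finset.univ_inter, hc0]; decide
      · rw [Finset.inter_self, hc0]; decide
      · have : P0ᶜ ∩ P0 = ∅ := by ext x; simp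
        rw [this]; simp
    have hx := f2 X hX
    have hy := f3 Y hY
    have e1 := card_symmDiff_GF8 (X ∩ P0) (Y ∩ P0)
    have e2 := card_symmDiff_GF8 ((X ∩ P0) ∆ (Y ∩ P0)) (Z ∩ P0)
    rw [← inter_sd] at e1
    rw [← inter_sd X Y, ← inter_sd] at e2
    have e3 := Finset.card_inter_add_card_sdiff (X ∆ Y ∆ Z) P0
    have hodd : Odd ((X ∆ Y ∆ Z) ∩ P0).card := by grind
    obtain ⟨k, hk⟩ := hodd
    omega
  refine ⟨?_, ?_⟩
  · intro X hX X' hX' Y hY Y' hY' W W' hW hW' hm hm'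
    constructor
    · rintro rfl
      rw [coset_eq_of_mem hm, coset_eq_of_mem hm']
    · intro heq
      have p := par X hX Y hY W hm hW
      have p' := par X' hX' Y' hY' W' hm' hW'
      rw [← heq, coset_eq_of_mem hm] at hm'
      have c1 := card_symmDiff_GF8 W W'
      have c2 := card_symmDiff_GF8 (W ∩ P0) (W' ∩ P0)
      rw [← inter_sd] at c2
      have c3 := card_symmDiff_GF8 (W \ P0) (W' \ P0)
      have e3 : (W \ P0) ∆ (W' \ P0) = (W ∆ W') \ P0 := by
        ext x; simp only [Finset.mem_symmDiff, Finset.mem_sdiff]; tauto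
      rw [e3] at c3
      rcases f1 _ hm' with h | h | h | h
      · exact symmDiff_eq_bot.1 h
      · rw [h, Finset.card_univ, card_GF8] at c1
        omega
      · rw [h, Finset.inter_self] at c2
        omega
      · have : P0ᶜ \ P0 = P1 := by
          rw [hcompl]; ext x; simp
        rw [h, this] at c3
        omega
  · ext W
    constructor
    · rintro ⟨X, hX, Y, hY, hm, hW⟩
      obtain ⟨p, q⟩ := par X hX Y hY W hm hW
      obtain ⟨r, hr⟩ := Finset.card_eq_one.1 p
      obtain ⟨s, hs⟩ := Finset.card_eq_one.1 q
      have hr' : r ∈ W ∩ P0 := by rw [hr]; simp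
      have hs' : s ∈ W \ P0 := by rw [hs]; simp
      refine ⟨r, (Finset.mem_inter.1 hr').2, s, ?_, ?_⟩
      · rw [hcompl]; exact Finset.mem_compl.2 (Finset.mem_sdiff.1 hs').2
      · have hu : W = (W ∩ P0) ∪ (W \ P0) := by
          ext x; simp only [Finset.mem_union, Finset.mem_inter, Finset.mem_sdiff]; tauto
        rw [hu, hr, hs]; rfl
    · rintro ⟨r, hr, s, hs, rfl⟩
      rw [hcompl] at hs
      obtain ⟨X, hX, hY⟩ := f4 r hr s hs
      refine ⟨X, hX, _, hY, ⟨∅, ⟨empty_mem_Hbar _, empty_mem_Hbar _⟩, ?_⟩, ?_⟩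
      · ext x; simp only [Finset.mem_symmDiff, Finset.notMem_empty]; tauto
      · apply Finset.card_pair
        rintro rfl
        exact Finset.mem_compl.1 hs hr
end

section
/- Let F = GF(8), let π : F → F be any bijection, and let D_P = {(X,Y) : X ∈ H_β and Y ∈ H_{π(β)} for some β ∈ F} be the Solov'eva code of length 16 built from the Phelps partition P = (H_β)_{β∈F} (so |D_P| = 2048). Then for every homogeneous pair (i,j) of distinct coordinates (i.e., both coordinates index the first block or both index the second block) and every codeword c ∈ D_P, the ij-component of c in D_P has cardinality 1024 = |D_P|/2; consequently D_P has exactly two maximal ij-components for every such pair. -/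
open scoped symmDiff

/-- The Solov'eva code `D_P = ∪_β H_β × H_{π(β)}` of length 16, built from the
Phelps partition. Codewords are pairs of subsets of `GF(8)`. -/
def DP (π : GaloisField 2 3 → GaloisField 2 3) :
    Set (Finset (GaloisField 2 3) × Finset (GaloisField 2 3)) :=
  {p | ∃ β, p.1 ∈ Hodd β ∧ p.2 ∈ Hodd (π β)}

/-- The distance on pairs: `d((X,Y),(X',Y')) = |X ∆ X'| + |Y ∆ Y'|`. -/
noncomputable def dist16 (p q : Finset (GaloisField 2 3) × Finset (GaloisField 2 3)) : ℕ :=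
  (p.1 ∆ q.1).card + (p.2 ∆ q.2).card

/-- `p` and `q` differ in the coordinate `c` (the 16 coordinates are indexed by
two disjoint copies of `GF(8)`). -/
def diffAt (p q : Finset (GaloisField 2 3) × Finset (GaloisField 2 3)) :
    GaloisField 2 3 ⊕ GaloisField 2 3 → Prop
  | Sum.inl a => a ∈ p.1 ∆ q.1
  | Sum.inr a => a ∈ p.2 ∆ q.2

/-- A pair of distinct coordinates is homogeneous if both belong to the first
block or both belong to the second block. -/
def Homogeneous (i j : GaloisField 2 3 ⊕ GaloisField 2 3) : Prop :=
  (i.isLeft ∧ j.isLeft) ∨ (i.isRight ∧ j.isRight)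

/-- `ij`-adjacency in the Solov'eva code `D_P`: both codewords in `D_P`,
at distance 4, differing in both coordinates `i` and `j`. -/
def adjDP (π : GaloisField 2 3 → GaloisField 2 3)
    (i j : GaloisField 2 3 ⊕ GaloisField 2 3)
    (p q : Finset (GaloisField 2 3) × Finset (GaloisField 2 3)) : Prop :=
  p ∈ DP π ∧ q ∈ DP π ∧ dist16 p q = 4 ∧ diffAt p q i ∧ diffAt p q j

namespace Sol

abbrev F := GaloisField 2 3

/-! ### Boolean model -/

def cu : ℕ → ℕ
  | 0 => 0 | 1 => 1 | 2 => 3 | 3 => 4 | 4 => 5 | 5 => 6 | 6 => 7 | 7 => 2 | _ => 0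

def tm (m b k : ℕ) : ℕ := bif m.testBit k then cu (k ^^^ b) else 0
def on (m k : ℕ) : ℕ := bif m.testBit k then 1 else 0

def syn (m b : ℕ) : ℕ :=
  tm m b 0 ^^^ tm m b 1 ^^^ tm m b 2 ^^^ tm m b 3 ^^^ tm m b 4 ^^^ tm m b 5 ^^^ tm m b 6 ^^^ tm m b 7

def pc (m : ℕ) : ℕ :=
  on m 0 + on m 1 + on m 2 + on m 3 + on m 4 + on m 5 + on m 6 + on m 7

def od (m : ℕ) : Bool := Nat.beq (pc m % 2) 1
def hod (m b : ℕ) : Bool := od m && Nat.beq (syn m b) 0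
def par (m : ℕ) : Bool := m.testBit 0 == m.testBit 1

def addNew (acc : List ℕ) (l : List ℕ) : List ℕ :=
  l.foldl (fun a x => bif a.any (Nat.beq x) then a else x :: a) acc

def bfs (nb : ℕ → List ℕ) : ℕ → List ℕ → List ℕ
  | 0, L => L
  | n + 1, L => bfs nb n (addNew L (L.flatMap nb))

theorem addNew_mem (l : List ℕ) : ∀ (acc : List ℕ) (x : ℕ), x ∈ addNew acc l → x ∈ acc ∨ x ∈ l := by
  induction l with
  | nil => intro acc x h; exact Or.inl h
  | cons y l ih =>
    intro acc x h
    have h' : x ∈ addNew (bif acc.any (Nat.beq y) then acc else y :: acc) l := h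
    rcases ih _ _ h' with h1 | h1
    · cases hb : acc.any (Nat.beq y) <;> rw [hb] at h1 <;> simp at h1 ⊢ <;> tauto
    · exact Or.inr (List.mem_cons_of_mem _ h1)

theorem bfs_sound (nb : ℕ → List ℕ) (R : ℕ → ℕ → Prop) (hR : ∀ a b, b ∈ nb a → R a b) (r : ℕ) (n : ℕ) :
    ∀ L : List ℕ, (∀ x ∈ L, Relation.ReflTransGen R r x) →
      ∀ x ∈ bfs nb n L, Relation.ReflTransGen R r x := by
  induction n with
  | zero => intro L h x hx; exact h x hx
  | succ n ih =>
    intro L h x hx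
    refine ih _ ?_ x hx
    intro y hy
    rcases addNew_mem _ _ _ hy with h1 | h1
    · exact h y h1
    · obtain ⟨a, ha, hb⟩ := List.mem_flatMap.1 h1
      exact (h a ha).tail (hR _ _ hb)

def pairsFrom (lo : ℕ) : List ℕ :=
  (List.range 8).flatMap fun a => (List.range a).flatMap fun b =>
    bif Nat.ble lo b then [1 <<< a ^^^ 1 <<< b] else []

def nbX (m : ℕ) : List ℕ :=
  (m ^^^ 3) :: (((pairsFrom 2).map fun q => m ^^^ (3 ^^^ q)).filter fun x =>
    (List.range 8).any fun b => hod m b && hod x b && Nat.beq (pc (m ^^^ x)) 4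
      && (m ^^^ x).testBit 0 && (m ^^^ x).testBit 1)

def nbY (m : ℕ) : List ℕ :=
  ((pairsFrom 0).map fun q => m ^^^ q).filter fun x =>
    ((hod m 0 && hod x 1) || (hod m 1 && hod x 0)) && Nat.beq (pc (m ^^^ x)) 2

def memX (r0 r1 : ℕ) : Bool :=
  let L0 := bfs nbX 8 [r0]
  let L1 := bfs nbX 8 [r1]
  (List.range 256).all fun m => !od m || (bif par m then L0 else L1).any (Nat.beq m)

def memY (r : ℕ) : Bool :=
  let L := bfs nbY 8 [r]
  (List.range 256).all fun m => !hod m 0 || L.any (Nat.beq m)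

set_option maxRecDepth 100000

theorem D1 : memX 4 1 = true := by decide +kernel
theorem D2 : memY 1 = true := by decide +kernel
theorem D3 : ((List.range 256).all fun m => !hod m 0 || (nbY m).any fun x => hod x 1 && Nat.ble x 255) = true := by
  decide +kernel
theorem D4 : ((List.range 256).all fun m => !od m || (List.range 8).any fun b => hod m b) = true := by
  decide +kernel
theorem D5 : ((List.range 256).all fun m => !(hod m 0 && hod m 1)) = true := by decide +kernel
theorem D6 : ((List.range 256).all fun m => (List.range 8).all fun b => !(hod m b && hod (m ^^^ 3) b)) = true := by
  decide +kernel
theorem D7 : ((List.range 256).filter fun m => hod m 0).length = 16 := by decide +kernel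
theorem D8 (c : Bool) : ((List.range 256).filter fun m => od m && (par m == c)).length = 64 := by
  cases c <;> decide +kernel


/-! ### The field -/

theorem two_F : (2 : F) = 0 := by
  have : ((2 : ℕ) : F) = 0 := CharP.cast_eq_zero F 2
  exact_mod_cast this

theorem card_F : Fintype.card F = 8 := by
  rw [← Nat.card_eq_fintype_card, GaloisField.card 2 3 (by norm_num)]; norm_num

theorem exists_alpha : ∃ α : F, α ^ 3 = α + 1 := by
  have h2 := two_F
  have : ∃ x : F, x ∉ ({0, 1} : Finset F) := by
    by_contra! h
    have h1 : (Finset.univ : Finset F) ⊆ {0, 1} := fun x _ => h x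
    have := Finset.card_le_card h1
    rw [Finset.card_univ, card_F] at this
    have := Finset.card_le_two (a := (0 : F)) (b := 1)
    omega
  obtain ⟨x, hx⟩ := this
  simp only [Finset.mem_insert, Finset.mem_singleton, not_or] at hx
  obtain ⟨h0, h1⟩ := hx
  have h7 : x ^ 7 = 1 := by
    have := FiniteField.pow_card_sub_one_eq_one x h0
    rwa [card_F] at this
  have hf : (x - 1) * ((x ^ 3 - x - 1) * (x ^ 3 - x ^ 2 - 1)) = 0 := by
    linear_combination h7 + (x ^ 3 - x ^ 6) * h2
  rcases mul_eq_zero.1 hf with h | h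
  · exact absurd (sub_eq_zero.1 h) h1
  rcases mul_eq_zero.1 h with h | h
  · exact ⟨x, by linear_combination h⟩
  · refine ⟨x⁻¹, ?_⟩
    field_simp
    linear_combination -h - x^2 * h2

/-- The element with coordinates given by the bits of `n`. -/
noncomputable def e0 (α : F) (n : ℕ) : F :=
  (bif n.testBit 0 then 1 else 0) + (bif n.testBit 1 then α else 0) + (bif n.testBit 2 then α ^ 2 else 0)

theorem e0_xor (α : F) (a b : ℕ) : e0 α (a ^^^ b) = e0 α a + e0 α b := by
  have h2 := two_F
  unfold e0
  simp only [Nat.testBit_xor]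
  cases a.testBit 0 <;> cases a.testBit 1 <;> cases a.testBit 2 <;> cases b.testBit 0 <;>
    cases b.testBit 1 <;> cases b.testBit 2 <;> simp only [Bool.xor_false, Bool.xor_true, Bool.not_true, Bool.not_false, cond_true, cond_false] <;> grind

theorem e0_zero (α : F) : e0 α 0 = 0 := by simp [e0]

theorem e0_ne {α : F} (hα : α ^ 3 = α + 1) (n : ℕ) (h0 : n ≠ 0) (h : n < 8) : e0 α n ≠ 0 := by
  have h2 := two_F
  have h1 : (1 : F) ≠ 0 := one_ne_zero
  intro hn
  unfold e0 at hn
  interval_cases n <;> simp [Nat.testBit, Nat.shiftRight_eq_div_pow] at hn h0 <;> grind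

theorem e0_cu {α : F} (hα : α ^ 3 = α + 1) (n : ℕ) (h : n < 8) : e0 α n ^ 3 = e0 α (cu n) := by
  have h2 := two_F
  unfold e0
  interval_cases n <;> simp [Nat.testBit, Nat.shiftRight_eq_div_pow, cu] <;> grind

/-! ### Affine coordinates and bitmasks -/

/-- An affine parametrisation of `F` by `0, …, 7`. -/
structure Coord (E : ℕ → F) : Prop where
  inj : ∀ a < 8, ∀ b < 8, E a = E b → a = b
  surj : ∀ x, ∃ a < 8, E a = x
  key : ∀ m : ℕ, ∀ b < 8, (∑ k ∈ Finset.range 8, if m.testBit k then (E k + E b) ^ 3 else 0) = 0 ↔ syn m b = 0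

theorem xor_lt8 {a b : ℕ} (ha : a < 8) (hb : b < 8) : a ^^^ b < 8 :=
  Nat.xor_lt_two_pow (n := 3) ha hb

theorem cu_lt (n : ℕ) : cu n < 8 := by
  unfold cu; split <;> norm_num

theorem tm_lt (m b k : ℕ) : tm m b k < 8 := by
  unfold tm; cases m.testBit k <;> simp [cu_lt]

theorem exists_coord (i j : F) (hij : i ≠ j) : ∃ E : ℕ → F, Coord E ∧ E 0 = i ∧ E 1 = j := by
  obtain ⟨α, hα⟩ := exists_alpha
  have h2 := two_F
  have hd : i + j ≠ 0 := by
    intro h; apply hij; linear_combination h - j * h2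
  have hinj0 : ∀ a < 8, ∀ b < 8, e0 α a = e0 α b → a = b := by
    intro a ha b hb h
    by_contra hne
    refine e0_ne hα (a ^^^ b) (by simpa [Nat.xor_eq_zero_iff] using hne) (xor_lt8 ha hb) ?_
    rw [e0_xor, h]; linear_combination e0 α b * h2
  have hinj : ∀ a < 8, ∀ b < 8, i + (i + j) * e0 α a = i + (i + j) * e0 α b → a = b := by
    intro a ha b hb h
    exact hinj0 a ha b hb (mul_left_cancel₀ hd (add_left_cancel h))
  refine ⟨fun n => i + (i + j) * e0 α n, ⟨hinj, ?_, ?_⟩, ?_, ?_⟩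
  · have hi : Function.Injective (fun n : Fin 8 => i + (i + j) * e0 α n) := fun a b h =>
      Fin.ext (hinj _ a.2 _ b.2 h)
    have hb := (Fintype.bijective_iff_injective_and_card _).2 ⟨hi, by rw [card_F]; simp⟩
    intro x
    obtain ⟨a, ha⟩ := hb.2 x
    exact ⟨a, a.2, ha⟩
  · intro m b hb
    have hterm : ∀ k < 8, (if m.testBit k then ((i + (i + j) * e0 α k) + (i + (i + j) * e0 α b)) ^ 3 else 0)
        = (i + j) ^ 3 * e0 α (tm m b k) := by
      intro k hk
      unfold tm
      cases m.testBit k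
      · simp [e0_zero]
      · simp only [if_true, cond_true]
        rw [← e0_cu hα _ (xor_lt8 hk hb), e0_xor, ← mul_pow]
        congr 1
        linear_combination i * h2
    rw [Finset.sum_congr rfl (fun k hk => hterm k (Finset.mem_range.1 hk)), ← Finset.mul_sum]
    have hs : ∑ k ∈ Finset.range 8, e0 α (tm m b k) = e0 α (syn m b) := by
      unfold syn
      simp only [e0_xor, Finset.sum_range_succ, Finset.sum_range_zero, zero_add]
    rw [hs, mul_eq_zero]
    constructor
    · rintro (h | h)
      · exact absurd (pow_eq_zero_iff (by norm_num) |>.1 h) hd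
      · by_contra hne
        refine e0_ne hα _ hne ?_ h
        unfold syn
        repeat' apply xor_lt8
        all_goals apply tm_lt
    · intro h; right; rw [h, e0_zero]
  · simp [e0_zero]
  · have : e0 α 1 = 1 := by simp [e0, Nat.testBit, Nat.shiftRight_eq_div_pow]
    simp only [this]; linear_combination i * h2

/-- The subset encoded by the mask `m`. -/
noncomputable def S (E : ℕ → F) (m : ℕ) : Finset F :=
  ((Finset.range 8).filter (fun k => m.testBit k)).image E

theorem mem_S {E : ℕ → F} (hE : Coord E) (m k : ℕ) (hk : k < 8) : E k ∈ S E m ↔ m.testBit k = true := by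
  simp only [S, Finset.mem_image, Finset.mem_filter, Finset.mem_range]
  constructor
  · rintro ⟨a, ⟨ha, h⟩, h'⟩
    rwa [← hE.inj a ha k hk h']
  · intro h; exact ⟨k, ⟨hk, h⟩, rfl⟩

theorem S_symm {E : ℕ → F} (hE : Coord E) (m n : ℕ) : S E m ∆ S E n = S E (m ^^^ n) := by
  ext x
  obtain ⟨k, hk, rfl⟩ := hE.surj x
  rw [Finset.mem_symmDiff, mem_S hE _ _ hk, mem_S hE _ _ hk, mem_S hE _ _ hk, Nat.testBit_xor]
  cases m.testBit k <;> cases n.testBit k <;> simp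

theorem S_sum {E : ℕ → F} (hE : Coord E) {M : Type*} [AddCommMonoid M] (m : ℕ) (f : F → M) :
    ∑ x ∈ S E m, f x = ∑ k ∈ Finset.range 8, if m.testBit k then f (E k) else 0 := by
  unfold S
  rw [Finset.sum_image, Finset.sum_filter]
  intro a ha b hb h
  simp only [Finset.coe_filter, Finset.mem_range, Set.mem_ofPred_eq] at ha hb
  exact hE.inj a ha.1 b hb.1 h

theorem S_card {E : ℕ → F} (hE : Coord E) (m : ℕ) : (S E m).card = pc m := by
  rw [Finset.card_eq_sum_ones, S_sum hE]
  simp only [Finset.sum_range_succ, Finset.sum_range_zero, zero_add, pc, on, Bool.cond_eq_ite]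

theorem S_odd {E : ℕ → F} (hE : Coord E) (m : ℕ) : Odd (S E m).card ↔ od m = true := by
  rw [S_card hE, Nat.odd_iff, od, Nat.beq_eq]

theorem S_hod {E : ℕ → F} (hE : Coord E) (m b : ℕ) (hb : b < 8) : S E m ∈ Hodd (E b) ↔ hod m b = true := by
  unfold Hodd hod
  rw [Set.mem_ofPred_eq, S_odd hE, S_sum hE, hE.key m b hb, Bool.and_eq_true, Nat.beq_eq]

theorem S_surj {E : ℕ → F} (hE : Coord E) (X : Finset F) : ∃ m < 256, S E m = X := by
  refine ⟨Nat.ofBits (fun k : Fin 8 => decide (E k ∈ X)), Nat.ofBits_lt_two_pow _, ?_⟩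
  ext x
  obtain ⟨k, hk, rfl⟩ := hE.surj x
  rw [mem_S hE _ _ hk, Nat.testBit_ofBits_lt _ _ hk]
  simp

theorem S_inj {E : ℕ → F} (hE : Coord E) (m n : ℕ) (hm : m < 256) (hn : n < 256) (h : S E m = S E n) : m = n := by
  apply Nat.eq_of_testBit_eq
  intro k
  by_cases hk : k < 8
  · rw [Bool.eq_iff_iff, ← mem_S hE _ _ hk, ← mem_S hE _ _ hk, h]
  · have h8 : 2 ^ 8 ≤ 2 ^ k := Nat.pow_le_pow_right (by norm_num) (by omega)
    rw [Nat.testBit_lt_two_pow (by omega), Nat.testBit_lt_two_pow (by omega)]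

theorem S_count {E : ℕ → F} (hE : Coord E) (P : Finset F → Prop) (q : ℕ → Bool) (h : ∀ m, P (S E m) ↔ q m = true) :
    {X | P X}.ncard = ((List.range 256).filter q).length := by
  have h1 : {X | P X} = (((Finset.range 256).filter (fun m => q m)).image (S E) : Finset (Finset F)) := by
    ext X
    obtain ⟨m, hm, rfl⟩ := S_surj hE X
    simp only [Set.mem_ofPred_eq, Finset.coe_image, Finset.coe_filter, Finset.mem_range, Set.mem_image]
    rw [h]
    constructor
    · intro hq; exact ⟨m, ⟨hm, hq⟩, rfl⟩
    · rintro ⟨n, ⟨hn, hq⟩, hs⟩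
      rwa [← S_inj hE n m hn hm hs]
  rw [h1, Set.ncard_coe_finset, Finset.card_image_of_injOn]
  · simp [Finset.card, Finset.filter, Finset.range, Multiset.range]
  · intro a ha b hb hs
    simp only [Finset.coe_filter, Finset.mem_range, Set.mem_ofPred_eq] at ha hb
    exact S_inj hE a b ha.1 hb.1 hs

/-! ### Facts about the codes `Hodd` -/

theorem all_range {n : ℕ} {q : ℕ → Bool} (h : (List.range n).all q = true) (m : ℕ) (hm : m < n) :
    q m = true := List.all_eq_true.1 h m (List.mem_range.2 hm)

theorem any_beq {L : List ℕ} {m : ℕ} (h : L.any (Nat.beq m) = true) : m ∈ L := by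
  obtain ⟨x, hx, hxm⟩ := List.any_eq_true.1 h
  rw [Nat.beq_eq] at hxm
  rwa [hxm]

theorem exists_other (β : F) : ∃ γ : F, β ≠ γ := (exists_ne β).imp fun _ h => h.symm

theorem H_odd {X : Finset F} {β : F} (h : X ∈ Hodd β) : Odd X.card := h.1

theorem H_exists (X : Finset F) (h : Odd X.card) : ∃ β, X ∈ Hodd β := by
  obtain ⟨E, hE, -, -⟩ := exists_coord 0 1 zero_ne_one
  obtain ⟨m, hm, rfl⟩ := S_surj hE X
  rw [S_odd hE] at h
  have := all_range D4 m hm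
  rw [h] at this
  obtain ⟨b, hb, hb'⟩ := List.any_eq_true.1 (by simpa using this : ((List.range 8).any fun b => hod m b) = true)
  exact ⟨E b, (S_hod hE m b (List.mem_range.1 hb)).2 hb'⟩

theorem H_unique (X : Finset F) (β γ : F) (h : X ∈ Hodd β) (h' : X ∈ Hodd γ) : β = γ := by
  by_contra hne
  obtain ⟨E, hE, h0, h1⟩ := exists_coord β γ hne
  obtain ⟨m, hm, rfl⟩ := S_surj hE X
  rw [← h0, S_hod hE _ _ (by norm_num)] at h
  rw [← h1, S_hod hE _ _ (by norm_num)] at h'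
  have := all_range D5 m hm
  simp [h, h'] at this

theorem H_card (γ : F) : {X | X ∈ Hodd γ}.ncard = 16 := by
  obtain ⟨δ, hδ⟩ := exists_other γ
  obtain ⟨E, hE, h0, h1⟩ := exists_coord γ δ hδ
  rw [← D7]
  apply S_count hE
  intro m
  rw [← h0, S_hod hE _ _ (by norm_num)]

def Par (i j : F) (X : Finset F) : Prop := (i ∈ X ↔ j ∈ X)

theorem S_par {E : ℕ → F} (hE : Coord E) (m : ℕ) : Par (E 0) (E 1) (S E m) ↔ par m = true := by
  unfold Par par
  rw [mem_S hE _ _ (by norm_num), mem_S hE _ _ (by norm_num), beq_iff_eq]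
  cases m.testBit 0 <;> cases m.testBit 1 <;> simp

theorem par_card (i j : F) (hij : i ≠ j) (p : Prop) :
    {X : Finset F | Odd X.card ∧ (Par i j X ↔ p)}.ncard = 64 := by
  classical
  obtain ⟨E, hE, rfl, rfl⟩ := exists_coord i j hij
  rw [← D8 (decide p)]
  apply S_count hE
  intro m
  rw [S_odd hE, S_par hE, Bool.and_eq_true, beq_iff_eq]
  by_cases hp : p <;> simp [hp]

theorem pair_eq {E : ℕ → F} (hE : Coord E) : ({E 0, E 1} : Finset F) = S E 3 := by
  ext x
  obtain ⟨k, hk, rfl⟩ := hE.surj x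
  rw [mem_S hE _ _ hk, Finset.mem_insert, Finset.mem_singleton]
  constructor
  · rintro (h | h)
    · rw [hE.inj _ hk 0 (by norm_num) h]; rfl
    · rw [hE.inj _ hk 1 (by norm_num) h]; rfl
  · intro h
    interval_cases k <;> first | exact Or.inl rfl | exact Or.inr rfl | exact absurd h (by decide)

theorem flip_odd (i j : F) (hij : i ≠ j) (X : Finset F) (h : Odd X.card) : Odd (X ∆ {i, j}).card := by
  have h1 : (X ∆ {i, j}).card + 2 * (X ∩ {i, j}).card = X.card + 2 := by
    have e : (X ∆ {i, j}) = (X \ {i, j}) ∪ ({i, j} \ X) := rfl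
    have h2 := Finset.card_sdiff_add_card_inter X {i, j}
    have h3 := Finset.card_sdiff_add_card_inter {i, j} X
    rw [Finset.card_pair hij, Finset.inter_comm] at h3
    rw [e, Finset.card_union_of_disjoint disjoint_sdiff_sdiff]
    omega
  rw [Nat.odd_iff] at *
  omega

theorem flip_ne (i j : F) (hij : i ≠ j) (X : Finset F) (β : F) (h : X ∈ Hodd β)
    (h' : X ∆ {i, j} ∈ Hodd β) : False := by
  obtain ⟨E, hE, rfl, rfl⟩ := exists_coord i j hij
  obtain ⟨m, hm, rfl⟩ := S_surj hE X
  obtain ⟨b, hb, rfl⟩ := hE.surj β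
  rw [pair_eq hE, S_symm hE, S_hod hE _ _ hb] at h'
  rw [S_hod hE _ _ hb] at h
  have := all_range (all_range D6 m hm) b hb
  simp [h, h'] at this

/-- Moves between two classes. -/
def RY (γ γ' : F) (A B : Finset F) : Prop :=
  ((A ∈ Hodd γ ∧ B ∈ Hodd γ') ∨ (A ∈ Hodd γ' ∧ B ∈ Hodd γ)) ∧ (A ∆ B).card = 2

theorem nbY_sound {E : ℕ → F} (hE : Coord E) (a b : ℕ) (h : b ∈ nbY a) :
    RY (E 0) (E 1) (S E a) (S E b) := by
  unfold nbY at h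
  have h' := (List.mem_filter.1 h).2
  unfold RY
  rw [S_hod hE _ _ (by norm_num), S_hod hE _ _ (by norm_num), S_hod hE _ _ (by norm_num),
    S_hod hE _ _ (by norm_num), S_symm hE, S_card hE, ← Nat.beq_eq]
  simpa using h'

theorem RY_symm {γ γ' : F} : Std.Symm (RY γ γ') := by
  constructor
  rintro A B ⟨h, h'⟩
  refine ⟨by tauto, by rwa [symmDiff_comm]⟩

theorem Y_step (γ γ' : F) (hne : γ ≠ γ') (Y : Finset F) (h : Y ∈ Hodd γ) :
    ∃ Y' ∈ Hodd γ', (Y ∆ Y').card = 2 := by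
  obtain ⟨E, hE, rfl, rfl⟩ := exists_coord γ γ' hne
  obtain ⟨m, hm, rfl⟩ := S_surj hE Y
  rw [S_hod hE _ _ (by norm_num)] at h
  have := all_range D3 m hm
  rw [h] at this
  obtain ⟨x, hx, hx'⟩ := List.any_eq_true.1 (by simpa using this :
    ((nbY m).any fun x => hod x 1 && Nat.ble x 255) = true)
  rw [Bool.and_eq_true] at hx'
  exact ⟨S E x, (S_hod hE _ _ (by norm_num)).2 hx'.1, (nbY_sound hE _ _ hx).2⟩

theorem Y_conn (γ γ' : F) (hne : γ ≠ γ') (Y Y' : Finset F) (h : Y ∈ Hodd γ) (h' : Y' ∈ Hodd γ) :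
    Relation.ReflTransGen (RY γ γ') Y Y' := by
  obtain ⟨E, hE, rfl, rfl⟩ := exists_coord γ γ' hne
  have key : ∀ Y, Y ∈ Hodd (E 0) → Relation.ReflTransGen (RY (E 0) (E 1)) (S E 1) Y := by
    intro Y h
    obtain ⟨m, hm, rfl⟩ := S_surj hE Y
    rw [S_hod hE _ _ (by norm_num)] at h
    have := all_range D2 m hm
    rw [h] at this
    have hmem := any_beq (by simpa using this : (bfs nbY 8 [1]).any (Nat.beq m) = true)
    have := bfs_sound nbY (fun a b => RY (E 0) (E 1) (S E a) (S E b)) (nbY_sound hE) 1 8 [1]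
      (by intro x hx; rw [List.mem_singleton.1 hx]) m hmem
    exact Relation.ReflTransGen.lift (S E) (fun _ _ h => h) _ _ this
  have := RY_symm (γ := E 0) (γ' := E 1)
  exact (Relation.ReflTransGen.stdSymm.symm _ _ (key Y h)).trans (key Y' h')

/-- Moves in the block which contains `i` and `j`. -/
def RX (i j : F) (A B : Finset F) : Prop :=
  B = A ∆ {i, j} ∨ ∃ β, A ∈ Hodd β ∧ B ∈ Hodd β ∧ (A ∆ B).card = 4 ∧ i ∈ A ∆ B ∧ j ∈ A ∆ B

theorem RX_symm {i j : F} : Std.Symm (RX i j) := by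
  constructor
  rintro A B (h | ⟨β, h1, h2, h3⟩)
  · left; rw [h, symmDiff_assoc, symmDiff_self, symmDiff_bot]
  · right; exact ⟨β, h2, h1, by rwa [symmDiff_comm]⟩

theorem nbX_sound {E : ℕ → F} (hE : Coord E) (a b : ℕ) (h : b ∈ nbX a) :
    RX (E 0) (E 1) (S E a) (S E b) := by
  unfold nbX at h
  rcases List.mem_cons.1 h with rfl | h
  · left; rw [pair_eq hE, S_symm hE]
  · right
    obtain ⟨c, hc, hc'⟩ := List.any_eq_true.1 (List.mem_filter.1 h).2
    have hc8 := List.mem_range.1 hc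
    refine ⟨E c, ?_⟩
    rw [S_hod hE _ _ hc8, S_hod hE _ _ hc8, S_symm hE, S_card hE, ← Nat.beq_eq,
      mem_S hE _ _ (by norm_num), mem_S hE _ _ (by norm_num)]
    simp only [Bool.and_eq_true] at hc'
    tauto

theorem X_conn (i j : F) (hij : i ≠ j) (X X' : Finset F) (h : Odd X.card) (h' : Odd X'.card)
    (hp : Par i j X ↔ Par i j X') : Relation.ReflTransGen (RX i j) X X' := by
  obtain ⟨E, hE, rfl, rfl⟩ := exists_coord i j hij
  have key : ∀ m < 256, od m = true →
      Relation.ReflTransGen (RX (E 0) (E 1)) (S E (bif par m then 4 else 1)) (S E m) := by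
    intro m hm h
    have := all_range D1 m hm
    rw [h] at this
    cases hpm : par m <;> rw [hpm] at this
    · have hmem := any_beq (by simpa using this : (bfs nbX 8 [1]).any (Nat.beq m) = true)
      have := bfs_sound nbX (fun a b => RX (E 0) (E 1) (S E a) (S E b)) (nbX_sound hE) 1 8 [1]
        (by intro x hx; rw [List.mem_singleton.1 hx]) m hmem
      exact Relation.ReflTransGen.lift (S E) (fun _ _ h => h) _ _ this
    · have hmem := any_beq (by simpa using this : (bfs nbX 8 [4]).any (Nat.beq m) = true)
      have := bfs_sound nbX (fun a b => RX (E 0) (E 1) (S E a) (S E b)) (nbX_sound hE) 4 8 [4]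
        (by intro x hx; rw [List.mem_singleton.1 hx]) m hmem
      exact Relation.ReflTransGen.lift (S E) (fun _ _ h => h) _ _ this
  obtain ⟨m, hm, rfl⟩ := S_surj hE X
  obtain ⟨n, hn, rfl⟩ := S_surj hE X'
  rw [S_odd hE] at h h'
  rw [S_par hE, S_par hE, ← Bool.eq_iff_iff] at hp
  have h1 := key m hm h
  have h2 := key n hn h'
  rw [hp] at h1
  have := RX_symm (i := E 0) (j := E 1)
  exact (Relation.ReflTransGen.stdSymm.symm _ _ h1).trans h2

/-! ### The Solov'eva code -/

theorem card_flip {i j : F} (hij : i ≠ j) (A : Finset F) : (A ∆ (A ∆ {i, j})).card = 2 := by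
  rw [symmDiff_symmDiff_cancel_left, Finset.card_pair hij]

theorem lift_X (π : F → F) (hπ : Function.Bijective π) (i j : F) (hij : i ≠ j) (A B : Finset F)
    (h : Relation.ReflTransGen (RX i j) A B) (Y : Finset F) (hY : (A, Y) ∈ DP π) :
    ∃ Y', (B, Y') ∈ DP π ∧
      Relation.ReflTransGen (adjDP π (Sum.inl i) (Sum.inl j)) (A, Y) (B, Y') := by
  induction h with
  | refl => exact ⟨Y, hY, .refl⟩
  | @tail B C _ hBC ih =>
    obtain ⟨Y', hY', hr⟩ := ih
    obtain ⟨β, hβ, hβ'⟩ := id hY'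
    simp only at hβ hβ'
    rcases hBC with rfl | ⟨δ, h1, h2, h3, h4, h5⟩
    · obtain ⟨β', hb'⟩ := H_exists _ (flip_odd i j hij B hβ.1)
      have hne : β ≠ β' := by
        rintro rfl; exact flip_ne i j hij B β hβ hb'
      obtain ⟨Y'', hY'', hc⟩ := Y_step (π β) (π β') (fun h => hne (hπ.1 h)) Y' hβ'
      have hD : (B ∆ {i, j}, Y'') ∈ DP π := ⟨β', hb', hY''⟩
      refine ⟨Y'', hD, hr.tail ⟨hY', hD, ?_, ?_, ?_⟩⟩
      · simp only [dist16, card_flip hij, hc]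
      · simp [diffAt, symmDiff_symmDiff_cancel_left]
      · simp [diffAt, symmDiff_symmDiff_cancel_left]
    · obtain rfl := H_unique B β δ hβ h1
      have hD : (C, Y') ∈ DP π := ⟨β, h2, hβ'⟩
      refine ⟨Y', hD, hr.tail ⟨hY', hD, ?_, h4, h5⟩⟩
      simp [dist16, h3]

theorem lift_Y (π : F → F) (hπ : Function.Bijective π) (i j : F) (hij : i ≠ j) (X Y Y' : Finset F)
    (h : (X, Y) ∈ DP π) (h' : (X, Y') ∈ DP π) :
      Relation.ReflTransGen (adjDP π (Sum.inl i) (Sum.inl j)) (X, Y) (X, Y') := by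
  classical
  obtain ⟨β, hβ, hY⟩ := h
  obtain ⟨δ, hδ, hY'⟩ := h'
  simp only at hβ hY hδ hY'
  obtain rfl := H_unique X β δ hβ hδ
  obtain ⟨β', hb'⟩ := H_exists _ (flip_odd i j hij X hβ.1)
  have hne : β ≠ β' := by
    rintro rfl; exact flip_ne i j hij X β hβ hb'
  have hne' : π β ≠ π β' := fun h => hne (hπ.1 h)
  have hc := Y_conn (π β) (π β') hne' Y Y' hY hY'
  let f : Finset F → Finset F × Finset F := fun Z => (if Z ∈ Hodd (π β) then X else X ∆ {i, j}, Z)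
  have hl := Relation.ReflTransGen.lift (r := RY (π β) (π β')) (p := adjDP π (Sum.inl i) (Sum.inl j)) f (by
    rintro A B ⟨⟨hA, hB⟩ | ⟨hA, hB⟩, hcard⟩
    · have hB' : B ∉ Hodd (π β) := fun h => hne' (H_unique B _ _ h hB)
      have eA : f A = (X, A) := by simp [f, hA]
      have eB : f B = (X ∆ {i, j}, B) := by simp [f, hB']
      show adjDP π _ _ (f A) (f B)
      rw [eA, eB]
      refine ⟨⟨β, hβ, hA⟩, ⟨β', hb', hB⟩, ?_, ?_, ?_⟩
      · simp only [dist16, card_flip hij, hcard]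
      · simp [diffAt, symmDiff_symmDiff_cancel_left]
      · simp [diffAt, symmDiff_symmDiff_cancel_left]
    · have hA' : A ∉ Hodd (π β) := fun h => hne' (H_unique A _ _ h hA)
      have eA : f A = (X ∆ {i, j}, A) := by simp [f, hA']
      have eB : f B = (X, B) := by simp [f, hB]
      show adjDP π _ _ (f A) (f B)
      rw [eA, eB]
      refine ⟨⟨β', hb', hA⟩, ⟨β, hβ, hB⟩, ?_, ?_, ?_⟩
      · simp only [dist16, symmDiff_comm _ X, card_flip hij, hcard]
      · simp [diffAt, symmDiff_comm _ X, symmDiff_symmDiff_cancel_left]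
      · simp [diffAt, symmDiff_comm _ X, symmDiff_symmDiff_cancel_left]) _ _ hc
  simpa only [Function.onFun, f, hY, hY', if_true] using hl

theorem par_inv (π : F → F) (i j : F) (p q : Finset F × Finset F)
    (h : Relation.ReflTransGen (adjDP π (Sum.inl i) (Sum.inl j)) p q) :
    Par i j q.1 ↔ Par i j p.1 := by
  induction h with
  | refl => rfl
  | tail _ h ih =>
    rw [← ih]
    obtain ⟨-, -, -, h4, h5⟩ := h
    simp only [diffAt, Finset.mem_symmDiff] at h4 h5
    unfold Par
    tauto

theorem comp_eq (π : F → F) (hπ : Function.Bijective π) (i j : F) (hij : i ≠ j)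
    (c : Finset F × Finset F) (hc : c ∈ DP π) :
    {c' ∈ DP π | Relation.ReflTransGen (adjDP π (Sum.inl i) (Sum.inl j)) c c'} =
      {c' ∈ DP π | Par i j c'.1 ↔ Par i j c.1} := by
  ext ⟨X', Y'⟩
  obtain ⟨X, Y⟩ := c
  refine and_congr_right fun hc' => ⟨par_inv π i j _ _, fun hp => ?_⟩
  have hX : Odd X.card := by obtain ⟨β, hβ, -⟩ := hc; exact hβ.1
  have hX' : Odd X'.card := by obtain ⟨β, hβ, -⟩ := hc'; exact hβ.1
  obtain ⟨Z, hZ, hr⟩ := lift_X π hπ i j hij X X' (X_conn i j hij X X' hX hX' hp.symm) Y hc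
  exact hr.trans (lift_Y π hπ i j hij X' Z Y' hZ hc')

theorem count (π : F → F) (i j : F) (hij : i ≠ j) (p : Prop) :
    {c' ∈ DP π | Par i j c'.1 ↔ p}.ncard = 1024 := by
  classical
  let A : Finset (Finset F) := {X : Finset F | Odd X.card ∧ (Par i j X ↔ p)}.toFinset
  let B : Finset F → Finset (Finset F) := fun X => {Y | (X, Y) ∈ DP π}.toFinset
  have h1 : {c' ∈ DP π | Par i j c'.1 ↔ p} =
      ((A.sigma B).map (Equiv.sigmaEquivProd (Finset F) (Finset F)).toEmbedding :
        Finset (Finset F × Finset F)) := by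
    ext ⟨X, Y⟩
    simp only [Finset.coe_map, Set.mem_image, Finset.mem_coe, Finset.mem_sigma, A, B,
      Set.mem_toFinset, Set.mem_ofPred_eq]
    constructor
    · rintro ⟨h, h'⟩
      refine ⟨⟨X, Y⟩, ⟨⟨?_, h'⟩, h⟩, rfl⟩
      obtain ⟨β, hβ, -⟩ := h; exact hβ.1
    · rintro ⟨⟨X', Y'⟩, ⟨⟨-, h'⟩, h⟩, heq⟩
      obtain ⟨rfl, rfl⟩ := Prod.mk.inj heq
      exact ⟨h, h'⟩
  have hA : A.card = 64 := by
    rw [← par_card i j hij p, Set.ncard_eq_toFinset_card']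
  have hB : ∀ X ∈ A, (B X).card = 16 := by
    intro X hX
    simp only [A, Set.mem_toFinset, Set.mem_ofPred_eq] at hX
    obtain ⟨β, hβ⟩ := H_exists X hX.1
    rw [← H_card (π β), Set.ncard_eq_toFinset_card']
    congr 1
    ext Y
    simp only [B, Set.mem_toFinset, Set.mem_ofPred_eq]
    constructor
    · rintro ⟨δ, h1, h2⟩
      rwa [H_unique X β δ hβ h1]
    · intro h; exact ⟨β, hβ, h⟩
  rw [h1, Set.ncard_coe_finset, Finset.card_map, Finset.card_sigma, Finset.sum_congr rfl hB,
    Finset.sum_const, hA]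
  norm_num

theorem main_left (π : F → F) (hπ : Function.Bijective π) (i j : F) (hij : i ≠ j)
    (c : Finset F × Finset F) (hc : c ∈ DP π) :
    {c' ∈ DP π | Relation.ReflTransGen (adjDP π (Sum.inl i) (Sum.inl j)) c c'}.ncard = 1024 := by
  rw [comp_eq π hπ i j hij c hc, count π i j hij]

theorem DP_swap (π ρ : F → F) (h : ∀ x, ρ (π x) = x) (h' : ∀ x, π (ρ x) = x)
    (c : Finset F × Finset F) : c.swap ∈ DP ρ ↔ c ∈ DP π := by
  constructor
  · rintro ⟨β, h1, h2⟩
    exact ⟨ρ β, h2, by rw [h']; exact h1⟩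
  · rintro ⟨β, h1, h2⟩
    exact ⟨π β, h2, by rw [h]; exact h1⟩

theorem adj_swap (π ρ : F → F) (h : ∀ x, ρ (π x) = x) (h' : ∀ x, π (ρ x) = x) (i j : F)
    (c d : Finset F × Finset F) :
    adjDP ρ (Sum.inl i) (Sum.inl j) c.swap d.swap ↔ adjDP π (Sum.inr i) (Sum.inr j) c d := by
  unfold adjDP
  rw [DP_swap π ρ h h', DP_swap π ρ h h']
  have : dist16 c.swap d.swap = dist16 c d := Nat.add_comm _ _
  rw [this]
  rfl

theorem main_right (π : F → F) (hπ : Function.Bijective π) (i j : F) (hij : i ≠ j)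
    (c : Finset F × Finset F) (hc : c ∈ DP π) :
    {c' ∈ DP π | Relation.ReflTransGen (adjDP π (Sum.inr i) (Sum.inr j)) c c'}.ncard = 1024 := by
  let e := Equiv.ofBijective π hπ
  have h : ∀ x, e.symm (π x) = x := fun x => e.symm_apply_apply x
  have h' : ∀ x, π (e.symm x) = x := fun x => e.apply_symm_apply x
  have hl := main_left e.symm e.symm.bijective i j hij c.swap ((DP_swap π _ h h' c).2 hc)
  rw [← hl, ← Set.ncard_image_of_injective _ Prod.swap_injective]
  congr 1
  ext d
  rw [Set.mem_image]
  constructor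
  · rintro ⟨d, ⟨h1, h2⟩, rfl⟩
    exact ⟨(DP_swap π _ h h' d).2 h1,
      Relation.ReflTransGen.lift Prod.swap (fun a b hab => (adj_swap π _ h h' i j a b).2 hab) _ _ h2⟩
  · rintro ⟨h1, h2⟩
    refine ⟨d.swap, ⟨(DP_swap π _ h h' d.swap).1 (by simpa using h1), ?_⟩, Prod.swap_swap d⟩
    have := Relation.ReflTransGen.lift (p := adjDP π (Sum.inr i) (Sum.inr j)) Prod.swap (fun a b hab =>
      (adj_swap π _ h h' i j a.swap b.swap).1 (by simpa using hab)) _ _ h2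
    simpa [Function.onFun] using this

end Sol

theorem stmt_12 (π : GaloisField 2 3 → GaloisField 2 3) (hπ : Function.Bijective π)
    (i j : GaloisField 2 3 ⊕ GaloisField 2 3) (hij : i ≠ j) (hhom : Homogeneous i j) :
    ∀ c ∈ DP π, {c' ∈ DP π | Relation.ReflTransGen (adjDP π i j) c c'}.ncard = 1024 := by
  intro c hc
  rcases i with i | i <;> rcases j with j | j
  · exact Sol.main_left π hπ i j (fun h => hij (by rw [h])) c hc
  · simp [Homogeneous] at hhom
  · simp [Homogeneous] at hhom
  · exact Sol.main_right π hπ i j (fun h => hij (by rw [h])) c hc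
end
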